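/- arXiv:2406.00254 — 6 statements merged into one kernel-verified Lean document; each statement's English description precedes it below -/
import Mathlib

section
/- Assume (ℓ, d) satisfies the Kupisch dichotomy. Then for every i ∈ ZMod n: (1) (c(i) : ℤ) − c(i+1) = 1 if and only if ℓ(i) = ℓ(i+1) + 1; and (2) if ℓ(i) ≤ ℓ(i+1), then (c(i) : ℤ) − c(i+1) = − Σ_{j=ℓ(i)}^{ℓ(i+1)} d(i+j+1), where the sum is over integers ℓ(i) ≤ j ≤ ℓ(i+1) with the argument i+j+1 reduced in ZMod n. -/
/-- The Kupisch dichotomy: for every `i`, either `l i = l (i+1) + 1` and `d (i+1) = 0`,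
or `l i ≤ l (i+1)` and `d (i+1) = l (i+1) - l i`. -/
def KupischDichotomy (n : ℕ) (l d : ZMod n → ℕ) : Prop :=
  ∀ i : ZMod n, (l i = l (i + 1) + 1 ∧ d (i + 1) = 0) ∨
    (l i ≤ l (i + 1) ∧ d (i + 1) = l (i + 1) - l i)

/-- `cLen n l d i = l i + ∑_{j=1}^{l i} d (i + j)`, the length of the `i`-th filtered
projective of the defect-invariant reverse algebra. -/
def cLen (n : ℕ) (l d : ZMod n → ℕ) (i : ZMod n) : ℕ :=
  l i + ∑ j ∈ Finset.Icc 1 (l i), d (i + (j : ZMod n))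

theorem stmt0 (n : ℕ) (hn : 1 ≤ n) (l d : ZMod n → ℕ)
    (hk : KupischDichotomy n l d) (i : ZMod n) :
    ((cLen n l d i : ℤ) - cLen n l d (i + 1) = 1 ↔ l i = l (i + 1) + 1) ∧
    (l i ≤ l (i + 1) →
      (cLen n l d i : ℤ) - cLen n l d (i + 1) =
        - ∑ j ∈ Finset.Icc (l i) (l (i + 1)), (d (i + (j : ZMod n) + 1) : ℤ)) := by
  have hrange : ∀ i : ZMod n, (cLen n l d i : ℤ) =
      l i + ∑ j ∈ Finset.range (l i), (d (i + (j : ZMod n) + 1) : ℤ) := by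
    intro i
    rw [cLen, ← Finset.Ico_add_one_right_eq_Icc, Finset.sum_Ico_eq_sum_range]
    push_cast
    congr 1
    refine Finset.sum_congr (by simp) fun j _ => ?_
    rw [add_comm (1 : ZMod n), add_assoc]
  have hshift : (cLen n l d (i + 1) : ℤ) = l (i + 1) +
      (∑ j ∈ Finset.range (l (i + 1) + 1), (d (i + (j : ZMod n) + 1) : ℤ) - d (i + 1)) := by
    rw [hrange, Finset.sum_range_succ']
    push_cast
    rw [add_zero, add_sub_cancel_right]
    congr 1
    refine Finset.sum_congr rfl fun j _ => ?_
    rw [add_right_comm i 1, add_assoc i (j : ZMod n) 1]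
  have hle : l i ≤ l (i + 1) → (cLen n l d i : ℤ) - cLen n l d (i + 1) =
      - ∑ j ∈ Finset.Icc (l i) (l (i + 1)), (d (i + (j : ZMod n) + 1) : ℤ) := by
    intro h
    have hd : d (i + 1) = l (i + 1) - l i := by
      rcases hk i with ⟨h', -⟩ | ⟨-, h'⟩
      · omega
      · exact h'
    rw [hshift, hrange, ← Finset.Ico_add_one_right_eq_Icc,
      Finset.sum_Ico_eq_sub _ (h.trans (Nat.le_add_right _ 1)), hd]
    push_cast [h]
    ring
  refine ⟨⟨fun h => ?_, fun h => ?_⟩, hle⟩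
  · rcases hk i with ⟨h', -⟩ | ⟨h', -⟩
    · exact h'
    · have hnonneg : 0 ≤ ∑ j ∈ Finset.Icc (l i) (l (i + 1)), (d (i + (j : ZMod n) + 1) : ℤ) :=
        Finset.sum_nonneg fun _ _ => Int.natCast_nonneg _
      have := hle h'
      omega
  · have hd : d (i + 1) = 0 := by
      rcases hk i with ⟨-, h'⟩ | ⟨h', -⟩
      · exact h'
      · omega
    rw [hshift, hrange, h, hd]
    push_cast
    ring
end

section
/- Assume (ℓ, d) satisfies the Kupisch dichotomy and that for every i ∈ ZMod n either ℓ(i) ≥ 2, or ℓ(i) = 1 and d(i+1) ≥ 1. Then the cyclic sequence K is an admissible Kupisch series: (a) every entry of K is at least 2, and (b) for every cyclic position k, if K(k) > K(k+1) then K(k) = K(k+1) + 1. -/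
/-- `aLen n l d i m = l i + ∑_{j=1}^{l i + m} d (i + j)`, the `m`-th entry of the `i`-th
block; for `m = 0` this is the length `c i` of the `i`-th filtered projective. -/
def aLen (n : ℕ) (l d : ZMod n → ℕ) (i : ZMod n) (m : ℕ) : ℕ :=
  l i + ∑ j ∈ Finset.Icc 1 (l i + m), d (i + (j : ZMod n))

/-- The cyclic sequence `K`: the concatenation over `i = 0, …, n-1` of the blocks
`(aLen i 0, aLen i 1, …, aLen i (d (i+1)))`. -/
def KSeq (n : ℕ) (l d : ZMod n → ℕ) : List ℕ :=
  (List.range n).flatMap (fun i =>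
    (List.range (d ((i : ZMod n) + 1) + 1)).map (fun m => aLen n l d (i : ZMod n) m))

/-- The entries of `K` read cyclically. -/
def KFun (n : ℕ) (l d : ZMod n → ℕ) (k : ℕ) : ℕ :=
  (KSeq n l d).getD (k % (KSeq n l d).length) 0

theorem aLen_mono (n : ℕ) (l d : ZMod n → ℕ) (i : ZMod n) : Monotone (aLen n l d i) := by
  intro a b hab
  unfold aLen
  gcongr

theorem aLen_last_le (n : ℕ) (l d : ZMod n → ℕ) (hk : KupischDichotomy n l d)
    (hl : ∀ i, 1 ≤ l i) (i : ZMod n) :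
    aLen n l d i (d (i + 1)) ≤ aLen n l d (i + 1) 0 + 1 := by
  have hsum (m : ℕ) : ∑ j ∈ Finset.Icc 1 (m + 1), d (i + (j : ZMod n)) =
      d (i + 1) + ∑ j ∈ Finset.Icc 1 m, d (i + 1 + (j : ZMod n)) := by
    induction m with
    | zero => simp
    | succ m ih =>
      rw [Finset.sum_Icc_succ_top (by omega), ih, Finset.sum_Icc_succ_top (by omega)]
      push_cast
      rw [show i + ((m : ZMod n) + 1 + 1) = i + 1 + ((m : ZMod n) + 1) by ring, add_assoc]
  unfold aLen
  rcases hk i with ⟨h, h0⟩ | ⟨h, h0⟩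
  · rw [h0, add_zero, h, hsum, h0]
    simp only [add_zero]
    omega
  · obtain ⟨m, hm⟩ : ∃ m, l (i + 1) = m + 1 := ⟨l (i + 1) - 1, by have := hl (i + 1); omega⟩
    rw [show l i + d (i + 1) = m + 1 by omega, hsum, add_zero]
    have : ∑ j ∈ Finset.Icc 1 m, d (i + 1 + (j : ZMod n)) ≤
        ∑ j ∈ Finset.Icc 1 (l (i + 1)), d (i + 1 + (j : ZMod n)) := by
      gcongr
      omega
    omega

theorem two_le_aLen (n : ℕ) (l d : ZMod n → ℕ)
    (hl : ∀ i : ZMod n, 2 ≤ l i ∨ (l i = 1 ∧ 1 ≤ d (i + 1))) (i : ZMod n) (m : ℕ) :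
    2 ≤ aLen n l d i m := by
  refine le_trans ?_ (aLen_mono n l d i (Nat.zero_le m))
  unfold aLen
  rcases hl i with h | ⟨h, h'⟩
  · omega
  · simp [h]
    omega

theorem KSeq_eq_flatMap (n : ℕ) (l d : ZMod n → ℕ) :
    KSeq n l d = (List.range n).flatMap (fun i : ℕ =>
      (List.range (d ((i : ZMod n) + 1) + 1)).map (fun m => aLen n l d (i : ZMod n) m)) := by
  simp [KSeq, List.flatMap_assoc]

theorem isChain_map_range_append_singleton {α : Type*} (R : α → α → Prop) (f : ℕ → α) (c : α)
    (N : ℕ) (hf : ∀ m < N, R (f m) (f (m + 1))) (hc : R (f N) c) :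
    List.IsChain R ((List.range (N + 1)).map f ++ [c]) := by
  induction N generalizing c with
  | zero => simpa using hc
  | succ N ih =>
    rw [List.range_succ, List.map_append, List.map_singleton, List.append_assoc,
      List.singleton_append, List.isChain_split]
    exact ⟨ih _ (fun m hm => hf m (by omega)) (hf N (by omega)), by simpa using hc⟩

theorem isChain_flatMap_range_append_singleton {α : Type*} (R : α → α → Prop)
    (f : ℕ → ℕ → α) (D : ℕ → ℕ) (hf : ∀ i, ∀ m < D i, R (f i m) (f i (m + 1)))
    (hD : ∀ i, R (f i (D i)) (f (i + 1) 0)) (N : ℕ) :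
    List.IsChain R
      ((List.range N).flatMap (fun i => (List.range (D i + 1)).map (f i)) ++ [f N 0]) := by
  induction N with
  | zero => simp
  | succ N ih =>
    have h := isChain_map_range_append_singleton R (f N) (f (N + 1) 0) (D N) (hf N) (hD N)
    rw [List.range_succ, List.flatMap_append, List.flatMap_singleton, List.append_assoc]
    rw [List.range_succ_eq_map, List.map_cons, List.cons_append] at h ⊢
    exact List.isChain_split.2 ⟨ih, h⟩

/-- A chain that closes up to its own head is a cyclic chain. -/
theorem List.IsChain.getD_mod {α : Type*} {R : α → α → Prop} {a x : α} {t : List α}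
    (h : List.IsChain R (a :: t ++ [a])) (k : ℕ) :
    R ((a :: t).getD (k % (a :: t).length) x) ((a :: t).getD ((k + 1) % (a :: t).length) x) := by
  have hr : k % (a :: t).length < (a :: t).length := Nat.mod_lt _ (by simp)
  have h1 := List.isChain_iff_getElem.1 h (k % (a :: t).length) (by simp at hr ⊢; omega)
  have hnext : (k + 1) % (a :: t).length =
      if k % (a :: t).length + 1 < (a :: t).length then k % (a :: t).length + 1 else 0 := by
    rw [← Nat.mod_add_mod]
    split_ifs with hlt
    · exact Nat.mod_eq_of_lt hlt
    · rw [show k % (a :: t).length + 1 = (a :: t).length by omega, Nat.mod_self]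
  rw [List.getElem_append_left hr] at h1
  rw [hnext, List.getD_eq_getElem _ _ hr]
  split_ifs with hlt
  · rw [List.getElem_append_left hlt] at h1
    rwa [List.getD_eq_getElem _ _ hlt]
  · rw [List.getElem_append_right (by omega)] at h1
    simpa using h1

theorem stmt2 (n : ℕ) (hn : 1 ≤ n) (l d : ZMod n → ℕ)
    (hk : KupischDichotomy n l d)
    (hl : ∀ i : ZMod n, 2 ≤ l i ∨ (l i = 1 ∧ 1 ≤ d (i + 1))) :
    (∀ x ∈ KSeq n l d, 2 ≤ x) ∧
    (∀ k : ℕ, KFun n l d k > KFun n l d (k + 1) →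
      KFun n l d k = KFun n l d (k + 1) + 1) := by
  refine ⟨?_, fun k hlt => ?_⟩
  · intro x hx
    simp only [KSeq, List.mem_flatMap, List.mem_map] at hx
    obtain ⟨i, -, m, -, rfl⟩ := hx
    exact two_le_aLen n l d hl i m
  · have hl1 (i : ZMod n) : 1 ≤ l i := by
      rcases hl i with h | h <;> omega
    have hchain := isChain_flatMap_range_append_singleton (fun x y : ℕ => x ≤ y + 1)
      (fun i m => aLen n l d (i : ZMod n) m) (fun i => d ((i : ZMod n) + 1))
      (fun i m _ => (aLen_mono n l d i (Nat.le_succ m)).trans (Nat.le_succ _))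
      (fun i => by simpa using aLen_last_le n l d hk hl1 i) n
    obtain ⟨t, ht⟩ : ∃ t, KSeq n l d = aLen n l d 0 0 :: t := by
      obtain ⟨n, rfl⟩ := Nat.exists_eq_add_of_le' hn
      simp [KSeq_eq_flatMap, List.range_succ_eq_map]
    rw [← KSeq_eq_flatMap, ZMod.natCast_self, ht] at hchain
    have h := hchain.getD_mod (x := 0) k
    rw [← ht] at h
    change KFun n l d k ≤ KFun n l d (k + 1) + 1 at h
    omega
end

section
/- Assume (ℓ, d) satisfies the Kupisch dichotomy and d(i) ≤ w(i) for all i. Let i ∈ ZMod n with w(i+1) = 0. Then exactly one of the following holds: either ℓ(i) = ℓ(i+1) + 1 and (z(i) : ℤ) − z(i+1) = 1, or ℓ(i) = ℓ(i+1) and (z(i) : ℤ) − z(i+1) = − w(i + ℓ(i) + 1) ≤ 0. In particular, (z(i) : ℤ) − z(i+1) = 1 if and only if ℓ(i) = ℓ(i+1) + 1. -/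
/-- `zLen n l w i = ∑_{j=1}^{l i} (w (i + j) + 1)`, the length of the `i`-th filtered
projective of a (generally non-defect-invariant) reverse algebra. -/
def zLen (n : ℕ) (l w : ZMod n → ℕ) (i : ZMod n) : ℕ :=
  ∑ j ∈ Finset.Icc 1 (l i), (w (i + (j : ZMod n)) + 1)

theorem sum_Icc_one_succ_shift {R M : Type*} [AddCommMonoidWithOne R] [AddCommMonoid M]
    (f : R → M) (i : R) (m : ℕ) :
    ∑ j ∈ Finset.Icc 1 (m + 1), f (i + (j : R)) =
      f (i + 1) + ∑ j ∈ Finset.Icc 1 m, f (i + 1 + (j : R)) := by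
  induction m with
  | zero => simp
  | succ m ih =>
    rw [Finset.sum_Icc_succ_top (by omega), ih, Finset.sum_Icc_succ_top (by omega), add_assoc]
    have h : i + ((m + 1 + 1 : ℕ) : R) = i + 1 + ((m + 1 : ℕ) : R) := by
      rw [Nat.cast_succ (m + 1), add_assoc, add_comm 1]
    rw [h]

theorem stmt4 (n : ℕ) (hn : 1 ≤ n) (l d w : ZMod n → ℕ)
    (hk : KupischDichotomy n l d) (hw : ∀ i : ZMod n, d i ≤ w i)
    (i : ZMod n) (hwi : w (i + 1) = 0) :
    Xor'
      (l i = l (i + 1) + 1 ∧ (zLen n l w i : ℤ) - zLen n l w (i + 1) = 1)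
      (l i = l (i + 1) ∧
        (zLen n l w i : ℤ) - zLen n l w (i + 1) =
          -(w (i + (l i : ZMod n) + 1) : ℤ) ∧
        (zLen n l w i : ℤ) - zLen n l w (i + 1) ≤ 0) ∧
    ((zLen n l w i : ℤ) - zLen n l w (i + 1) = 1 ↔ l i = l (i + 1) + 1) := by
  have hshift := sum_Icc_one_succ_shift (fun k => w k + 1) i (l (i + 1))
  have htop := Finset.sum_Icc_succ_top (Nat.le_add_left 1 (l (i + 1)))
    (fun j : ℕ => w (i + (j : ZMod n)) + 1)
  rw [Nat.cast_succ] at htop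
  beta_reduce at hshift
  rw [hwi] at hshift
  have hcases : l i = l (i + 1) + 1 ∨ l i = l (i + 1) := by
    have := hw (i + 1)
    rcases hk i with h | h <;> omega
  unfold zLen
  rcases hcases with h | h
  · have hz : ((∑ j ∈ Finset.Icc 1 (l i), (w (i + (j : ZMod n)) + 1) : ℕ) : ℤ) -
        (∑ j ∈ Finset.Icc 1 (l (i + 1)), (w (i + 1 + (j : ZMod n)) + 1) : ℕ) = 1 := by
      rw [h, hshift]
      push_cast
      ring
    exact ⟨Or.inl ⟨⟨h, hz⟩, fun h' => by omega⟩, fun _ => h, fun _ => hz⟩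
  · have hz : ((∑ j ∈ Finset.Icc 1 (l i), (w (i + (j : ZMod n)) + 1) : ℕ) : ℤ) -
        (∑ j ∈ Finset.Icc 1 (l (i + 1)), (w (i + 1 + (j : ZMod n)) + 1) : ℕ) =
        -(w (i + (l i : ZMod n) + 1) : ℤ) := by
      rw [h, add_assoc i]
      have := htop.symm.trans hshift
      zify at this
      push_cast
      linarith
    exact ⟨Or.inr ⟨⟨h, hz, by rw [hz]; omega⟩, fun h' => by omega⟩,
      fun h' => by rw [hz] at h'; omega, fun h' => by omega⟩
end

section
/- Assume (ℓ, d) satisfies the Kupisch dichotomy, d(i) ≤ w(i) for all i, and for every i ∈ ZMod n either ℓ(i) ≥ 2, or ℓ(i) = 1 and d(i+1) ≥ 1. Then the cyclic sequence K is an admissible Kupisch series: (a) every entry of K is at least 2, and (b) for every cyclic position k, if K(k) > K(k+1) then K(k) = K(k+1) + 1. -/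
/-- `vBlock n l w t i m = z i - m + ∑_{j=1}^{t i m} (w (i + l i + j) + 1)`,
the `m`-th entry of the `i`-th block. -/
def vBlock (n : ℕ) (l w : ZMod n → ℕ) (t : ZMod n → ℕ → ℕ) (i : ZMod n) (m : ℕ) : ℤ :=
  (zLen n l w i : ℤ) - m +
    ∑ j ∈ Finset.Icc 1 (t i m), ((w (i + (l i : ZMod n) + (j : ZMod n)) : ℤ) + 1)

/-- The cyclic sequence `K`: the concatenation over `i = 0, …, n-1` of the blocks
`(vBlock i 0, vBlock i 1, …, vBlock i (w (i+1)))`. -/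
def KSeqW (n : ℕ) (l w : ZMod n → ℕ) (t : ZMod n → ℕ → ℕ) : List ℤ :=
  (List.range n).flatMap (fun i =>
    (List.range (w ((i : ZMod n) + 1) + 1)).map (fun m => vBlock n l w t (i : ZMod n) m))

/-- The entries of `K` read cyclically. -/
def KFunW (n : ℕ) (l w : ZMod n → ℕ) (t : ZMod n → ℕ → ℕ) (k : ℕ) : ℤ :=
  (KSeqW n l w t).getD (k % (KSeqW n l w t).length) 0

theorem zLen_eq_range (n : ℕ) (l w : ZMod n → ℕ) (i : ZMod n) :
    zLen n l w i = ∑ j ∈ Finset.range (l i), (w (i + 1 + (j : ZMod n)) + 1) := by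
  unfold zLen
  rw [← Finset.Ico_succ_right_eq_Icc, Finset.sum_Ico_eq_sum_range]
  refine Finset.sum_congr (by simp) fun j _ => ?_
  push_cast
  rw [add_assoc]

theorem vBlock_eq_range (n : ℕ) (l w : ZMod n → ℕ) (t : ZMod n → ℕ → ℕ) (i : ZMod n) (m : ℕ) :
    vBlock n l w t i m =
      ((∑ j ∈ Finset.range (l i + t i m), (w (i + 1 + (j : ZMod n)) + 1) : ℕ) : ℤ) - m := by
  unfold vBlock
  rw [zLen_eq_range, Finset.sum_range_add, ← Finset.Ico_succ_right_eq_Icc,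
    Finset.sum_Ico_eq_sum_range]
  push_cast
  rw [add_sub_right_comm]
  congr 1
  refine Finset.sum_congr (by simp) fun j _ => ?_
  rw [show i + (l i : ZMod n) + (1 + (j : ZMod n)) = i + 1 + ((l i : ZMod n) + j) by ring]

/-- If the sequence drops from `a` to `b`, it drops by exactly one. -/
def DescendsByOne (a b : ℤ) : Prop := b < a → a = b + 1

theorem vBlock_descends (n : ℕ) (l w : ZMod n → ℕ) (t : ZMod n → ℕ → ℕ) (i : ZMod n) (m : ℕ)
    (h : t i (m + 1) = t i m ∨ t i (m + 1) = t i m + 1) :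
    DescendsByOne (vBlock n l w t i m) (vBlock n l w t i (m + 1)) := by
  unfold DescendsByOne
  rw [vBlock_eq_range, vBlock_eq_range]
  rcases h with h | h
  · rw [h]; push_cast; intro; ring
  · rw [h, ← add_assoc, Finset.sum_range_succ]; push_cast; intro; linarith

theorem vBlock_descends_to_next (n : ℕ) (l d w : ZMod n → ℕ) (t : ZMod n → ℕ → ℕ)
    (hk : KupischDichotomy n l d) (i : ZMod n) (hi : 1 ≤ l i) (h0 : t (i + 1) 0 = 0)
    (hend : t i (w (i + 1)) = d (i + 1)) :
    DescendsByOne (vBlock n l w t i (w (i + 1))) (vBlock n l w t (i + 1) 0) := by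
  have key (L : ℕ) : ∑ j ∈ Finset.range (L + 1), (w (i + 1 + (j : ZMod n)) + 1) =
      ∑ j ∈ Finset.range L, (w (i + 1 + 1 + (j : ZMod n)) + 1) + (w (i + 1) + 1) := by
    rw [Finset.sum_range_succ']
    congr 1
    · refine Finset.sum_congr rfl fun j _ => ?_
      rw [show i + 1 + ((j + 1 : ℕ) : ZMod n) = i + 1 + 1 + j by push_cast; ring]
    · simp
  unfold DescendsByOne
  rw [vBlock_eq_range, vBlock_eq_range, hend, h0]
  rcases hk i with ⟨h1, h2⟩ | ⟨h1, h2⟩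
  · rw [h1, h2, add_zero, key]; push_cast; intro; ring
  · obtain ⟨L, hL⟩ : ∃ L, l (i + 1) = L + 1 := ⟨l (i + 1) - 1, by omega⟩
    rw [show l i + d (i + 1) = L + 1 by omega, hL, key, add_zero, Finset.sum_range_succ]
    push_cast; intro; linarith

theorem two_le_vBlock (n : ℕ) (l d w : ZMod n → ℕ) (t : ZMod n → ℕ → ℕ) (i : ZMod n)
    (hl : 2 ≤ l i ∨ (l i = 1 ∧ 1 ≤ d (i + 1))) (hend : t i (w (i + 1)) = d (i + 1))
    (m : ℕ) (hm : m ≤ w (i + 1)) : 2 ≤ vBlock n l w t i m := by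
  rw [vBlock_eq_range]
  have key (L : ℕ) (hL : 1 ≤ L) : w (i + 1) + L ≤
      ∑ j ∈ Finset.range L, (w (i + 1 + (j : ZMod n)) + 1) := by
    induction L, hL using Nat.le_induction with
    | base => simp
    | succ L _ ih => rw [Finset.sum_range_succ]; omega
  have h := key (l i + t i m) (by omega)
  rcases hm.eq_or_lt with rfl | hlt <;> omega

/-- The `i`-th block of the cyclic sequence `K`. -/
def vBlockList (n : ℕ) (l w : ZMod n → ℕ) (t : ZMod n → ℕ → ℕ) (i : ZMod n) : List ℤ :=
  (List.range (w (i + 1) + 1)).map (vBlock n l w t i)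

theorem KSeqW_eq_flatMap (n : ℕ) (l w : ZMod n → ℕ) (t : ZMod n → ℕ → ℕ) :
    KSeqW n l w t = (List.range n).flatMap fun i : ℕ => vBlockList n l w t (i : ZMod n) := by
  simp [KSeqW, vBlockList, List.flatMap_assoc]

theorem isChain_flatMap_vBlockList (n : ℕ) (l w : ZMod n → ℕ) (t : ZMod n → ℕ → ℕ)
    (R : ℤ → ℤ → Prop)
    (hin : ∀ i m, m < w (i + 1) → R (vBlock n l w t i m) (vBlock n l w t i (m + 1)))
    (hout : ∀ i, R (vBlock n l w t i (w (i + 1))) (vBlock n l w t (i + 1) 0)) (N : ℕ) :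
    ((List.range N).flatMap fun i : ℕ => vBlockList n l w t (i : ZMod n)).IsChain R := by
  rw [List.flatMap_def, List.isChain_flatten (by simp [vBlockList])]
  constructor
  · intro L hL
    obtain ⟨i, -, rfl⟩ := List.mem_map.1 hL
    rw [List.isChain_iff_getElem]
    intro m hm
    simp only [vBlockList, List.length_map, List.length_range] at hm
    simpa [vBlockList] using hin i m (by omega)
  · rw [List.isChain_iff_getElem]
    intro i _ x hx y hy
    simp [vBlockList, List.range_succ] at hx
    simp [vBlockList, List.range_succ_eq_map] at hy
    subst hx hy
    exact hout i

theorem getD_mod_rel_of_isChain_append {α : Type*} (R : α → α → Prop) (K B : List α) (x : α)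
    (hK : K ≠ []) (hB : B ≠ []) (hhead : B.head? = K.head?) (h : (K ++ B).IsChain R) (k : ℕ) :
    R (K.getD (k % K.length) x) (K.getD ((k + 1) % K.length) x) := by
  have hpos : 0 < K.length := List.length_pos_iff.2 hK
  have hBpos : 0 < B.length := List.length_pos_iff.2 hB
  have hr : k % K.length < K.length := Nat.mod_lt _ hpos
  have hc := List.isChain_iff_getElem.1 h (k % K.length) (by rw [List.length_append]; omega)
  rw [List.getElem_append_left hr] at hc
  rw [List.getD_eq_getElem _ _ hr]
  rcases Nat.lt_or_ge (k % K.length + 1) K.length with h1 | h1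
  · rw [List.getElem_append_left h1] at hc
    have : (k + 1) % K.length = k % K.length + 1 := by
      rw [← Nat.mod_add_mod, Nat.mod_eq_of_lt h1]
    rw [this, List.getD_eq_getElem _ _ h1]
    exact hc
  · have h2 : k % K.length + 1 = K.length := by omega
    have : (k + 1) % K.length = 0 := by rw [← Nat.mod_add_mod, h2, Nat.mod_self]
    rw [this, List.getD_eq_getElem _ _ hpos]
    rw [List.getElem_append_right h1] at hc
    have h3 : B[0] = K[0] := by
      rw [List.head?_eq_getElem?, List.head?_eq_getElem?, List.getElem?_eq_getElem hBpos,
        List.getElem?_eq_getElem hpos] at hhead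
      exact Option.some.inj hhead
    simpa [h2, h3] using hc

theorem stmt6 (n : ℕ) (hn : 1 ≤ n) (l d w : ZMod n → ℕ)
    (hk : KupischDichotomy n l d) (hw : ∀ i : ZMod n, d i ≤ w i)
    (hl : ∀ i : ZMod n, 2 ≤ l i ∨ (l i = 1 ∧ 1 ≤ d (i + 1)))
    (t : ZMod n → ℕ → ℕ)
    (ht0 : ∀ i : ZMod n, t i 0 = 0)
    (htend : ∀ i : ZMod n, t i (w (i + 1)) = d (i + 1))
    (htstep : ∀ i : ZMod n, ∀ m : ℕ, m < w (i + 1) →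
      t i (m + 1) = t i m ∨ t i (m + 1) = t i m + 1) :
    (∀ x ∈ KSeqW n l w t, (2 : ℤ) ≤ x) ∧
    (∀ k : ℕ, KFunW n l w t k > KFunW n l w t (k + 1) →
      KFunW n l w t k = KFunW n l w t (k + 1) + 1) := by
  refine ⟨fun x hx => ?_, fun k => ?_⟩
  · simp only [KSeqW_eq_flatMap, vBlockList, List.mem_flatMap, List.mem_map, List.mem_range] at hx
    obtain ⟨i, -, m, hm, rfl⟩ := hx
    exact two_le_vBlock n l d w t i (hl i) (htend i) m (by omega)
  · have hchain := isChain_flatMap_vBlockList n l w t DescendsByOne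
      (fun i m hm => vBlock_descends n l w t i m (htstep i m hm))
      (fun i => vBlock_descends_to_next n l d w t hk i (by have := hl i; omega) (ht0 _) (htend i))
      (n + 1)
    rw [List.range_succ, List.flatMap_append, ← KSeqW_eq_flatMap] at hchain
    obtain ⟨n, rfl⟩ : ∃ n', n = n' + 1 := ⟨n - 1, by omega⟩
    refine getD_mod_rel_of_isChain_append DescendsByOne (KSeqW (n + 1) l w t)
      _ 0 ?_ ?_ ?_ hchain k
    · simp [KSeqW_eq_flatMap, vBlockList, List.range_succ_eq_map]
    · simp [vBlockList]
    · rw [KSeqW_eq_flatMap, List.range_succ_eq_map (n := n)]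
      have h0 : ((n + 1 : ℕ) : ZMod (n + 1)) = 0 := ZMod.natCast_self _
      simp only [List.flatMap_cons, List.flatMap_nil, List.append_nil, h0]
      simp [vBlockList, List.range_succ_eq_map]
end

section
/- Assume (ℓ, d) satisfies the Kupisch dichotomy, d(i) ≤ w(i) for all i, and for every i ∈ ZMod n either ℓ(i) ≥ 2, or ℓ(i) = 1 and d(i+1) ≥ 1. Then, for the cyclic sequence K of length N = n + Σ_i w(i), the number of cyclic positions k with K(k) ≤ K(k+1) equals n, and the number of cyclic positions k with K(k) > K(k+1) equals Σ_i w(i). -/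
/-- The sum of `w + 1` over the `k` indices following `i`. -/
def arcSum {n : ℕ} (w : ZMod n → ℕ) (i : ZMod n) (k : ℕ) : ℤ :=
  ∑ j ∈ Finset.range k, ((w (i + ((j + 1 : ℕ) : ZMod n)) : ℤ) + 1)

theorem sum_Icc_one_eq_sum_range (f : ℕ → ℤ) (k : ℕ) :
    ∑ j ∈ Finset.Icc 1 k, f j = ∑ j ∈ Finset.range k, f (j + 1) := by
  induction k with
  | zero => simp
  | succ k ih => rw [Finset.sum_Icc_succ_top (by omega), ih, Finset.sum_range_succ]

theorem arcSum_succ {n : ℕ} (w : ZMod n → ℕ) (i : ZMod n) (k : ℕ) :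
    arcSum w i (k + 1) = arcSum w i k + (w (i + ((k + 1 : ℕ) : ZMod n)) + 1) :=
  Finset.sum_range_succ _ _

theorem arcSum_succ_left {n : ℕ} (w : ZMod n → ℕ) (i : ZMod n) (k : ℕ) :
    arcSum w i (k + 1) = (w (i + 1) + 1) + arcSum w (i + 1) k := by
  unfold arcSum
  rw [Finset.sum_range_succ', add_comm]
  congr 1
  · simp
  · refine Finset.sum_congr rfl fun j _ => ?_
    rw [show i + ((j + 1 + 1 : ℕ) : ZMod n) = i + 1 + ((j + 1 : ℕ) : ZMod n) by
      push_cast; ring]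

theorem vBlock_eq_arcSum (n : ℕ) (l w : ZMod n → ℕ) (t : ZMod n → ℕ → ℕ) (i : ZMod n) (m : ℕ) :
    vBlock n l w t i m = arcSum w i (l i + t i m) - m := by
  have hz : (zLen n l w i : ℤ) = arcSum w i (l i) := by
    unfold zLen arcSum
    push_cast
    rw [sum_Icc_one_eq_sum_range (fun j => (w (i + (j : ZMod n)) : ℤ) + 1)]
    push_cast
    rfl
  have hs : arcSum w i (l i + t i m) = arcSum w i (l i) +
      ∑ j ∈ Finset.Icc 1 (t i m), ((w (i + (l i : ZMod n) + (j : ZMod n)) : ℤ) + 1) := by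
    rw [sum_Icc_one_eq_sum_range
      (fun j => (w (i + (l i : ZMod n) + (j : ZMod n)) : ℤ) + 1)]
    unfold arcSum
    rw [Finset.sum_range_add]
    congr 1
    refine Finset.sum_congr rfl fun j _ => ?_
    rw [show i + ((l i + j + 1 : ℕ) : ZMod n) = i + (l i : ZMod n) + ((j + 1 : ℕ) : ZMod n) by
      push_cast; ring]
  rw [vBlock, hz, hs]
  ring

theorem length_flatMap_range_map {α : Type*} (c : ℕ → ℕ) (g : ℕ → ℕ → α) (n : ℕ) :
    ((List.range n).flatMap fun i => (List.range (c i)).map (g i)).length =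
      ∑ i ∈ Finset.range n, c i := by
  induction n with
  | zero => simp
  | succ n ih => rw [List.range_succ, List.flatMap_append, List.length_append, ih,
      Finset.sum_range_succ]; simp

theorem getD_flatMap_range_map {α : Type*} (c : ℕ → ℕ) (g : ℕ → ℕ → α) (a : α) (n i m : ℕ)
    (hi : i < n) (hm : m < c i) :
    ((List.range n).flatMap fun i => (List.range (c i)).map (g i)).getD
      (∑ j ∈ Finset.range i, c j + m) a = g i m := by
  induction n with
  | zero => omega
  | succ n ih =>
    rw [List.range_succ, List.flatMap_append]
    rcases Nat.lt_succ_iff_lt_or_eq.mp hi with h | rfl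
    · rw [List.getD_append _ _ _ _ ?_, ih h]
      rw [length_flatMap_range_map]
      calc _ < ∑ j ∈ Finset.range (i + 1), c j := by rw [Finset.sum_range_succ]; omega
        _ ≤ _ := Finset.sum_le_sum_of_subset (Finset.range_mono h)
    · rw [List.getD_append_right _ _ _ _ (by rw [length_flatMap_range_map]; omega),
        length_flatMap_range_map]
      simp [List.getD_eq_getElem?_getD, hm]

theorem sum_range_sum_range {M : Type*} [AddCommMonoid M] (c : ℕ → ℕ) (f : ℕ → M) (n : ℕ) :
    ∑ k ∈ Finset.range (∑ i ∈ Finset.range n, c i), f k =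
      ∑ i ∈ Finset.range n, ∑ m ∈ Finset.range (c i), f (∑ j ∈ Finset.range i, c j + m) := by
  induction n with
  | zero => simp
  | succ n ih => rw [Finset.sum_range_succ, Finset.sum_range_add, ih, Finset.sum_range_succ]

theorem vBlock_le_succ_iff (n : ℕ) (l w : ZMod n → ℕ) (t : ZMod n → ℕ → ℕ) (i : ZMod n) (m : ℕ)
    (h : t i (m + 1) = t i m ∨ t i (m + 1) = t i m + 1) :
    (if vBlock n l w t i m ≤ vBlock n l w t i (m + 1) then (1 : ℤ) else 0) =
      t i (m + 1) - t i m := by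
  rw [vBlock_eq_arcSum, vBlock_eq_arcSum]
  rcases h with h | h
  · rw [h, if_neg (by push_cast; omega)]
    ring
  · rw [h, ← add_assoc, arcSum_succ, if_pos (by push_cast; omega)]
    push_cast
    ring

theorem vBlock_last_le_vBlock_zero (n : ℕ) (l d w : ZMod n → ℕ) (t : ZMod n → ℕ → ℕ)
    (hk : KupischDichotomy n l d) (ht0 : ∀ i, t i 0 = 0)
    (htend : ∀ i, t i (w (i + 1)) = d (i + 1)) (i : ZMod n) (hl : 1 ≤ l (i + 1)) :
    (if vBlock n l w t i (w (i + 1)) ≤ vBlock n l w t (i + 1) 0 then (1 : ℤ) else 0) =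
      1 + l (i + 1) - l i - d (i + 1) := by
  rw [vBlock_eq_arcSum, vBlock_eq_arcSum, ht0, htend]
  rcases hk i with ⟨h1, h2⟩ | ⟨h1, h2⟩
  · rw [h1, h2, add_zero, add_zero, arcSum_succ_left, if_neg (by push_cast; omega)]
    push_cast
    ring
  · obtain ⟨k, hk'⟩ : ∃ k, l (i + 1) = k + 1 := ⟨l (i + 1) - 1, by omega⟩
    rw [show l i + d (i + 1) = k + 1 by omega, hk', add_zero, arcSum_succ_left, arcSum_succ,
      if_pos (by push_cast; omega)]
    push_cast
    omega

theorem KSeqW_eq_flatMap_range (n : ℕ) (l w : ZMod n → ℕ) (t : ZMod n → ℕ → ℕ) :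
    KSeqW n l w t = (List.range n).flatMap fun i : ℕ =>
      (List.range (w ((i : ZMod n) + 1) + 1)).map (vBlock n l w t (i : ZMod n)) := by
  simp [KSeqW, List.bind_eq_flatMap, List.flatMap_assoc]

theorem length_KSeqW (n : ℕ) (l w : ZMod n → ℕ) (t : ZMod n → ℕ → ℕ) :
    (KSeqW n l w t).length = ∑ i ∈ Finset.range n, (w ((i : ZMod n) + 1) + 1) := by
  rw [KSeqW_eq_flatMap_range]
  exact length_flatMap_range_map (fun i : ℕ => w ((i : ZMod n) + 1) + 1)
    (fun i m => vBlock n l w t (i : ZMod n) m) n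

theorem KFunW_prefix_add (n : ℕ) (l w : ZMod n → ℕ) (t : ZMod n → ℕ → ℕ) (i m : ℕ)
    (hi : i < n) (hm : m ≤ w ((i : ZMod n) + 1)) :
    KFunW n l w t (∑ j ∈ Finset.range i, (w ((j : ZMod n) + 1) + 1) + m) =
      vBlock n l w t i m := by
  have hlt : ∑ j ∈ Finset.range i, (w ((j : ZMod n) + 1) + 1) + m <
      (KSeqW n l w t).length := by
    rw [length_KSeqW]
    calc _ < ∑ j ∈ Finset.range (i + 1), (w ((j : ZMod n) + 1) + 1) := by
          rw [Finset.sum_range_succ]; omega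
      _ ≤ _ := Finset.sum_le_sum_of_subset (Finset.range_mono hi)
  rw [KFunW, Nat.mod_eq_of_lt hlt, KSeqW_eq_flatMap_range]
  exact getD_flatMap_range_map (fun i : ℕ => w ((i : ZMod n) + 1) + 1)
    (fun i m => vBlock n l w t (i : ZMod n) m) 0 n i m hi (Nat.lt_succ_of_le hm)

theorem KFunW_prefix_succ (n : ℕ) (l w : ZMod n → ℕ) (t : ZMod n → ℕ → ℕ) (i : ℕ) (hi : i < n) :
    KFunW n l w t (∑ j ∈ Finset.range (i + 1), (w ((j : ZMod n) + 1) + 1)) =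
      vBlock n l w t ((i : ZMod n) + 1) 0 := by
  rcases Nat.lt_or_ge (i + 1) n with h | h
  · simpa using KFunW_prefix_add n l w t (i + 1) 0 h (Nat.zero_le _)
  · obtain rfl : n = i + 1 := by omega
    have h0 := KFunW_prefix_add (i + 1) l w t 0 0 i.succ_pos (Nat.zero_le _)
    have hcast : (i : ZMod (i + 1)) + 1 = ((0 : ℕ) : ZMod (i + 1)) := by
      have := ZMod.natCast_self (i + 1)
      push_cast at this ⊢
      exact this
    rw [hcast, ← h0]
    rw [KFunW, KFunW, ← length_KSeqW (i + 1) l w t, Nat.mod_self]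
    simp

theorem card_ascents_KFunW (n : ℕ) (l d w : ZMod n → ℕ) (t : ZMod n → ℕ → ℕ)
    (hk : KupischDichotomy n l d) (hl : ∀ i, 1 ≤ l i) (ht0 : ∀ i, t i 0 = 0)
    (htend : ∀ i, t i (w (i + 1)) = d (i + 1))
    (htstep : ∀ i m, m < w (i + 1) → t i (m + 1) = t i m ∨ t i (m + 1) = t i m + 1) :
    ((Finset.range (KSeqW n l w t).length).filter
      (fun k => KFunW n l w t k ≤ KFunW n l w t (k + 1))).card = n := by
  have hblock : ∀ i ∈ Finset.range n, ∑ m ∈ Finset.range (w ((i : ZMod n) + 1) + 1),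
      (if KFunW n l w t (∑ j ∈ Finset.range i, (w ((j : ZMod n) + 1) + 1) + m) ≤
        KFunW n l w t (∑ j ∈ Finset.range i, (w ((j : ZMod n) + 1) + 1) + m + 1)
        then (1 : ℤ) else 0) = 1 + ((l ((i + 1 : ℕ) : ZMod n) : ℤ) - l (i : ZMod n)) := by
    intro i hi
    rw [Finset.mem_range] at hi
    have hinner : ∀ m ∈ Finset.range (w ((i : ZMod n) + 1)),
        (if KFunW n l w t (∑ j ∈ Finset.range i, (w ((j : ZMod n) + 1) + 1) + m) ≤
          KFunW n l w t (∑ j ∈ Finset.range i, (w ((j : ZMod n) + 1) + 1) + m + 1)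
          then (1 : ℤ) else 0) = (t i (m + 1) : ℤ) - t i m := by
      intro m hm
      rw [Finset.mem_range] at hm
      rw [add_assoc _ m 1, KFunW_prefix_add n l w t i m hi hm.le,
        KFunW_prefix_add n l w t i (m + 1) hi hm]
      exact vBlock_le_succ_iff n l w t i m (htstep _ m hm)
    rw [Finset.sum_range_succ, Finset.sum_congr rfl hinner,
      Finset.sum_range_sub (fun m => (t i m : ℤ)), KFunW_prefix_add n l w t i _ hi le_rfl,
      add_assoc _ _ 1, ← Finset.sum_range_succ (fun j : ℕ => w ((j : ZMod n) + 1) + 1),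
      KFunW_prefix_succ n l w t i hi,
      vBlock_last_le_vBlock_zero n l d w t hk ht0 htend i (hl _), ht0, htend]
    push_cast
    ring
  have hsum : (((Finset.range (KSeqW n l w t).length).filter
      (fun k => KFunW n l w t k ≤ KFunW n l w t (k + 1))).card : ℤ) = n := by
    rw [Finset.card_filter, length_KSeqW]
    push_cast
    rw [sum_range_sum_range, Finset.sum_congr rfl hblock, Finset.sum_add_distrib,
      Finset.sum_range_sub (fun i : ℕ => (l (i : ZMod n) : ℤ))]
    simp
  exact_mod_cast hsum

theorem stmt7 (n : ℕ) (hn : 1 ≤ n) (l d w : ZMod n → ℕ)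
    (hk : KupischDichotomy n l d) (hw : ∀ i : ZMod n, d i ≤ w i)
    (hl : ∀ i : ZMod n, 2 ≤ l i ∨ (l i = 1 ∧ 1 ≤ d (i + 1)))
    (t : ZMod n → ℕ → ℕ)
    (ht0 : ∀ i : ZMod n, t i 0 = 0)
    (htend : ∀ i : ZMod n, t i (w (i + 1)) = d (i + 1))
    (htstep : ∀ i : ZMod n, ∀ m : ℕ, m < w (i + 1) →
      t i (m + 1) = t i m ∨ t i (m + 1) = t i m + 1) :
    (KSeqW n l w t).length = n + ∑ i ∈ Finset.range n, w (i : ZMod n) ∧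
    ((Finset.range (KSeqW n l w t).length).filter
        (fun k => KFunW n l w t k ≤ KFunW n l w t (k + 1))).card = n ∧
    ((Finset.range (KSeqW n l w t).length).filter
        (fun k => KFunW n l w t k > KFunW n l w t (k + 1))).card =
      ∑ i ∈ Finset.range n, w (i : ZMod n) := by
  have hlen : (KSeqW n l w t).length = n + ∑ i ∈ Finset.range n, w (i : ZMod n) := by
    have hshift : ∑ i ∈ Finset.range n, w ((i : ZMod n) + 1) =
        ∑ i ∈ Finset.range n, w (i : ZMod n) := by
      have h1 := Finset.sum_range_succ (fun i : ℕ => w (i : ZMod n)) n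
      have h2 := Finset.sum_range_succ' (fun i : ℕ => w (i : ZMod n)) n
      simp only [ZMod.natCast_self, Nat.cast_zero, Nat.cast_add, Nat.cast_one] at h1 h2
      omega
    rw [length_KSeqW, Finset.sum_add_distrib, hshift]
    simp [add_comm]
  have hasc := card_ascents_KFunW n l d w t hk
    (fun i => by rcases hl i with h | h <;> omega) ht0 htend htstep
  have hsplit := Finset.card_filter_add_card_filter_not (s := Finset.range (KSeqW n l w t).length)
    (fun k => KFunW n l w t k ≤ KFunW n l w t (k + 1))
  simp only [not_le, Finset.card_range] at hsplit
  refine ⟨hlen, hasc, ?_⟩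
  simp only [gt_iff_lt]
  omega
end

section
/- Let d := #{i ∈ ZMod n : f(i) = 2} and assume d ≥ 1. Define the cyclic sequence K of length N = n + d as the concatenation, over i = 0, 1, …, n−1 in this cyclic order, of blocks: block i is the single entry c(i) if f(i) = 1, and the pair (c(i), 1 + c(i+1)) if f(i) = 2; positions of K are read cyclically. Then K is an admissible Kupisch series: (a) every entry of K is at least 2, and (b) for every cyclic position k, if K(k) > K(k+1) then K(k) = K(k+1) + 1. -/
/-- `cSelf n m f i = ∑_{j=0}^{m-1} f (i + j)`, where `m` is the common length of the
indecomposable projectives of a selfinjective cyclic Nakayama algebra of rank `n` and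
`f : ZMod n → ℕ` (with values in `{1, 2}`) records the lengths of the base-set modules. -/
def cSelf (n m : ℕ) (f : ZMod n → ℕ) (i : ZMod n) : ℕ :=
  ∑ j ∈ Finset.range m, f (i + (j : ZMod n))

/-- The cyclic sequence `K`: the concatenation over `i = 0, …, n-1` of the blocks which
are the single entry `c i` when `f i = 1`, and the pair `(c i, 1 + c (i+1))` when
`f i = 2`. -/
def KSelf (n m : ℕ) (f : ZMod n → ℕ) : List ℕ :=
  (List.range n).flatMap (fun i =>
    if f (i : ZMod n) = 2 then
      [cSelf n m f (i : ZMod n), 1 + cSelf n m f ((i : ZMod n) + 1)]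
    else
      [cSelf n m f (i : ZMod n)])

/-- The entries of `K` read cyclically. -/
def KFunSelf (n m : ℕ) (f : ZMod n → ℕ) (k : ℕ) : ℕ :=
  (KSelf n m f).getD (k % (KSelf n m f).length) 0

theorem cSelf_add_apply (n m : ℕ) (f : ZMod n → ℕ) (i : ZMod n) :
    cSelf n m f (i + 1) + f i = cSelf n m f i + f (i + m) := by
  have h := Finset.sum_range_succ (fun j : ℕ => f (i + (j : ZMod n))) m
  rw [Finset.sum_range_succ'] at h
  simpa [cSelf, add_assoc, add_comm, add_left_comm] using h

theorem le_cSelf {n : ℕ} (m : ℕ) {f : ZMod n → ℕ} (hf : ∀ i, 1 ≤ f i) (i : ZMod n) :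
    m ≤ cSelf n m f i := by
  simpa [cSelf] using
    Finset.card_nsmul_le_sum (Finset.range m) (fun j : ℕ => f (i + (j : ZMod n))) 1
      fun j _ => hf _

/-- Concatenated blocks form a chain if each block, followed by the head of the next one, does. -/
theorem List.isChain_flatMap_range_append {α : Type*} {R : α → α → Prop} {c : ℕ → α}
    {t : ℕ → List α} (h : ∀ i, List.IsChain R (c i :: (t i ++ [c (i + 1)]))) (k : ℕ) :
    List.IsChain R ((List.range k).flatMap (fun i => c i :: t i) ++ [c k]) := by
  induction k with
  | zero => simp
  | succ k ih =>
    rw [List.range_succ, List.flatMap_append, List.flatMap_singleton, List.append_assoc,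
      List.cons_append, List.isChain_split]
    exact ⟨ih, h k⟩

/-- A list whose extension by its own first entry is a chain is a chain when read cyclically. -/
theorem List.IsChain.rel_getD_mod {α : Type*} {R : α → α → Prop} {a d : α} {l : List α}
    (h : List.IsChain R (a :: l ++ [a])) (k : ℕ) :
    R ((a :: l).getD (k % (a :: l).length) d) ((a :: l).getD ((k + 1) % (a :: l).length) d) := by
  have hk : k % (a :: l).length < (a :: l).length := Nat.mod_lt _ (by simp)
  have hR := List.isChain_iff_getElem.mp h (k % (a :: l).length) (by simpa using hk)
  rw [List.getElem_append_left hk] at hR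
  rw [List.getD_eq_getElem _ _ hk]
  rcases Nat.lt_or_ge (k % (a :: l).length + 1) (a :: l).length with hlt | hge
  · have hmod : (k + 1) % (a :: l).length = k % (a :: l).length + 1 := by
      rw [← Nat.mod_add_mod, Nat.mod_eq_of_lt hlt]
    rw [List.getElem_append_left hlt] at hR
    rwa [hmod, List.getD_eq_getElem _ _ hlt]
  · have heq : k % (a :: l).length + 1 = (a :: l).length := le_antisymm hk hge
    have hmod : (k + 1) % (a :: l).length = 0 := by
      rw [← Nat.mod_add_mod, heq, Nat.mod_self]
    rw [List.getElem_append_right hge, List.getElem_singleton] at hR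
    rwa [hmod, List.getD_cons_zero]

theorem KSelf_eq_flatMap_cons (n m : ℕ) (f : ZMod n → ℕ) :
    KSelf n m f = (List.range n).flatMap (fun i : ℕ => cSelf n m f i ::
      if f i = 2 then [1 + cSelf n m f (i + 1)] else []) := by
  simp only [KSelf, List.bind_eq_flatMap, List.flatMap_assoc, List.pure_def,
    List.flatMap_singleton]
  congr 1
  funext i
  split_ifs <;> rfl

theorem KSelf_isChain (n m : ℕ) {f : ZMod n → ℕ} (hf : ∀ i, f i = 1 ∨ f i = 2) :
    List.IsChain (fun a b => a ≤ b + 1) (KSelf n m f ++ [cSelf n m f 0]) := by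
  have h := List.isChain_flatMap_range_append (R := fun a b : ℕ => a ≤ b + 1)
    (c := fun i : ℕ => cSelf n m f i)
    (t := fun i : ℕ => if f i = 2 then [1 + cSelf n m f (i + 1)] else [])
    (fun i => by
      have hc := cSelf_add_apply n m f i
      have hfm := hf (i + m)
      have hfi := hf i
      split_ifs with h2 <;> simp <;> omega) n
  rw [KSelf_eq_flatMap_cons]
  simpa using h

theorem stmt9 (n m : ℕ) (hn : 1 ≤ n) (hm : 2 ≤ m) (f : ZMod n → ℕ)
    (hf : ∀ i : ZMod n, f i = 1 ∨ f i = 2)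
    (hd : 1 ≤ ((Finset.range n).filter (fun i : ℕ => f ((i : ℕ) : ZMod n) = 2)).card) :
    (∀ x ∈ KSelf n m f, 2 ≤ x) ∧
    (∀ k : ℕ, KFunSelf n m f k > KFunSelf n m f (k + 1) →
      KFunSelf n m f k = KFunSelf n m f (k + 1) + 1) := by
  have hf1 : ∀ i, 1 ≤ f i := fun i => by have := hf i; omega
  refine ⟨fun x hx => ?_, fun k hk => ?_⟩
  · rw [KSelf_eq_flatMap_cons] at hx
    obtain ⟨i, -, hx⟩ := List.mem_flatMap.mp hx
    have h0 := le_cSelf m hf1 i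
    have h1 := le_cSelf m hf1 (i + 1)
    split_ifs at hx <;> simp at hx <;> omega
  · have hchain := KSelf_isChain n m hf
    obtain ⟨l, hl⟩ : ∃ l, KSelf n m f = cSelf n m f 0 :: l := by
      obtain ⟨p, rfl⟩ := Nat.exists_eq_add_of_le' hn
      rw [KSelf_eq_flatMap_cons, List.range_succ_eq_map, List.flatMap_cons, List.cons_append,
        Nat.cast_zero]
      exact ⟨_, rfl⟩
    rw [hl] at hchain
    have := hchain.rel_getD_mod (d := 0) k
    rw [← hl] at this
    exact le_antisymm this hk
end
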